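/- arXiv:2405.19144 — 6 statements merged into one kernel-verified Lean document; each statement's English description precedes it below -/
import Mathlib

section
/- Let X be a Hausdorff topological space and K : ℕ → Set X a sequence of compact subsets with K n ⊆ K (n+1) for all n. Then the direct limit Y = ⋃ₙ K n, equipped with the final topology, is a Hausdorff topological space. -/
/-- Let `X` be a Hausdorff topological space and `K : ℕ → Set X` a sequence
of compact subsets with `K n ⊆ K (n+1)`. Then the direct limit `Y = ⋃ n, K n`, equipped with
the final topology (a set `U ⊆ Y` is open iff for every `n` its preimage in `K n`, i.e.
`U ∩ K n` with the subspace topology, is open), is Hausdorff. -/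
theorem direct_limit_of_compacts_t2
    {X : Type*} [TopologicalSpace X] [T2Space X]
    (K : ℕ → Set X) (hK : ∀ n, IsCompact (K n)) (hmono : ∀ n, K n ⊆ K (n + 1))
    (t : TopologicalSpace (↥(⋃ n, K n)))
    (ht : ∀ U : Set (↥(⋃ n, K n)),
      t.IsOpen U ↔ ∀ n, IsOpen (Set.inclusion (Set.subset_iUnion K n) ⁻¹' U)) :
    @T2Space (↥(⋃ n, K n)) t := by
  -- The final topology is finer than the Hausdorff subspace topology inherited from `X`.
  have hval : @Continuous _ _ t _ (Subtype.val : ↥(⋃ n, K n) → X) := by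
    refine @Continuous.mk _ _ t _ _ fun U hU => (ht _).2 fun n => ?_
    exact hU.preimage continuous_subtype_val
  exact @T2Space.of_injective_continuous _ _ t _ _ _ Subtype.val_injective hval
end

section
/- Let X be a Hausdorff topological space and K : ℕ → Set X a sequence of compact subsets with K n ⊆ K (n+1) for all n, and equip Y = ⋃ₙ K n with the final topology. A subset A ⊆ Y is compact in the final topology if and only if A is closed in the final topology and there exists n with A ⊆ K n. -/
/-- Let `X` be a Hausdorff topological space and `K : ℕ → Set X` a sequence
of compact subsets with `K n ⊆ K (n+1)`, and equip `Y = ⋃ n, K n` with the final topology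
(a set `U ⊆ Y` is open iff for every `n` its preimage in `K n` is open in the subspace
topology). A subset `A ⊆ Y` is compact in the final topology iff it is closed in the final
topology and contained in some `K n`. -/
theorem direct_limit_of_compacts_isCompact_iff
    {X : Type*} [TopologicalSpace X] [T2Space X]
    (K : ℕ → Set X) (hK : ∀ n, IsCompact (K n)) (hmono : ∀ n, K n ⊆ K (n + 1))
    (t : TopologicalSpace (↥(⋃ n, K n)))
    (ht : ∀ U : Set (↥(⋃ n, K n)),
      t.IsOpen U ↔ ∀ n, IsOpen (Set.inclusion (Set.subset_iUnion K n) ⁻¹' U))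
    (A : Set (↥(⋃ n, K n))) :
    @IsCompact _ t A ↔ @IsClosed _ t A ∧ ∃ n, ∀ x ∈ A, (x : X) ∈ K n := by
  have hle : Monotone K := monotone_nat_of_le_succ hmono
  have hopen : ∀ U : Set (↥(⋃ n, K n)),
      IsOpen U ↔ ∀ n, IsOpen (Set.inclusion (Set.subset_iUnion K n) ⁻¹' U) := ht
  have hincl : ∀ n, Continuous (Set.inclusion (Set.subset_iUnion K n)) := fun n =>
    ⟨fun U hU => (hopen U).1 hU n⟩
  have hval : Continuous (fun x : ↥(⋃ n, K n) => (x : X)) :=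
    ⟨fun V hV => (hopen _).2 fun n => hV.preimage continuous_subtype_val⟩
  have hT2 : T2Space (↥(⋃ n, K n)) := T2Space.of_injective_continuous Subtype.val_injective hval
  constructor
  · intro hA
    refine ⟨hA.isClosed, ?_⟩
    by_contra! hne
    choose x hxA hxK using hne
    -- The complements of the tails of `x` form an increasing open cover.
    have htail : ∀ n, IsOpen (x '' Set.Ici n)ᶜ := by
      intro n
      refine (hopen _).2 fun m => ?_
      rw [Set.preimage_compl, isOpen_compl_iff]
      refine Set.Finite.isClosed (Set.Finite.subset (((Set.finite_Iio m).image x).preimage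
        (Set.inclusion_injective (Set.subset_iUnion K m)).injOn) ?_)
      rintro y ⟨k, -, hk⟩
      refine ⟨k, Set.mem_Iio.2 (lt_of_not_ge fun hmk => hxK k ?_), hk⟩
      rw [hk]
      exact hle hmk y.2
    obtain ⟨n, hn⟩ := hA.elim_directed_cover (fun n => (x '' Set.Ici n)ᶜ) htail
      (by
        intro y _
        obtain ⟨m, hm⟩ := Set.mem_iUnion.1 y.2
        refine Set.mem_iUnion.2 ⟨m, ?_⟩
        rintro ⟨k, hmk, rfl⟩
        exact hxK k (hle hmk hm))
      (Monotone.directed_le fun m n hmn =>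
        Set.compl_subset_compl.2 (Set.image_mono (Set.Ici_subset_Ici.2 hmn)))
    exact hn (hxA n) ⟨n, Set.self_mem_Ici, rfl⟩
  · rintro ⟨hA, n, hn⟩
    have : CompactSpace (K n) := isCompact_iff_compactSpace.1 (hK n)
    have himage := (hA.preimage (hincl n)).isCompact.image (hincl n)
    rwa [Set.image_preimage_eq_of_subset fun y hy => ⟨⟨y, hn y hy⟩, rfl⟩] at himage
end

section
/- Let X be a Hausdorff topological space and (x_i)_{i∈ℕ} a sequence in X such that no element of the sequence is a limit point of the sequence, i.e., for every i there is an open neighbourhood U of x_i such that {j ∈ ℕ | x_j ∈ U} is finite. Then for any x ∈ X, the sequence (x_i) converges to x if and only if the subset {x_i | i ∈ ℕ} ∪ {x} of X is compact. -/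
/-- Let `X` be a Hausdorff space and `(x i)` a sequence in `X` such that no
element of the sequence is a limit point of the sequence: for every `i` there is an open
neighbourhood `U` of `x i` such that `{j | x j ∈ U}` is finite. Then for any `x₀ ∈ X`, the
sequence converges to `x₀` iff the subset `{x i | i ∈ ℕ} ∪ {x₀}` of `X` is compact. -/
theorem tendsto_iff_isCompact_range_union_singleton
    {X : Type*} [TopologicalSpace X] [T2Space X]
    (x : ℕ → X)
    (hx : ∀ i, ∃ U : Set X, IsOpen U ∧ x i ∈ U ∧ {j : ℕ | x j ∈ U}.Finite)
    (x₀ : X) :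
    Filter.Tendsto x Filter.atTop (nhds x₀) ↔
      IsCompact (Set.range x ∪ {x₀}) := by
  rw [Set.union_singleton]
  refine ⟨fun h ↦ h.isCompact_insert_range, fun hc ↦ ?_⟩
  refine hc.tendsto_nhds_of_unique_mapClusterPt
    (.of_forall fun i ↦ Set.mem_insert_of_mem _ (Set.mem_range_self i)) ?_
  rintro y (rfl | ⟨i, rfl⟩) hy
  · rfl
  · obtain ⟨U, hU, hi, hfin⟩ := hx i
    exact absurd hfin
      (Nat.frequently_atTop_iff_infinite.1 (hy.frequently (hU.mem_nhds hi)))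
end

section
/- Let X be a Hausdorff topological space and K : ℕ → Set X a sequence of compact subsets with K n ⊆ K (n+1) for all n, and equip Y = ⋃ₙ K n with the final topology. A sequence (y_i)_{i∈ℕ} in Y converges to a point y ∈ Y in the final topology if and only if there exists n ∈ ℕ such that y ∈ K n, y_i ∈ K n for all i, and y_i converges to y in the topology of X. -/
/-- A sequence in the union of an increasing sequence of sets that eventually lies in one of the
sets lies entirely in one of them. -/
theorem exists_forall_mem_of_eventually_mem {X : Type*} {K : ℕ → Set X} (hK : Monotone K)
    {u : ℕ → X} (hu : ∀ i, u i ∈ ⋃ n, K n) {n : ℕ} (hn : ∀ᶠ i in Filter.atTop, u i ∈ K n) :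
    ∃ m, ∀ i, u i ∈ K m := by
  obtain ⟨N, hN⟩ := Filter.eventually_atTop.1 hn
  choose k hk using fun i => Set.mem_iUnion.1 (hu i)
  refine ⟨max n ((Finset.range N).sup k), fun i => ?_⟩
  rcases lt_or_ge i N with hi | hi
  · exact hK ((Finset.le_sup (Finset.mem_range.2 hi)).trans (le_max_right _ _)) (hk i)
  · exact hK (le_max_left _ _) (hN i hi)

/-- In the final topology on the union of an increasing sequence of T₁ subspaces, a convergent
sequence eventually lies in one of the subspaces. -/
theorem exists_eventually_mem_of_tendsto_final {X : Type*} [TopologicalSpace X] [T1Space X]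
    {K : ℕ → Set X} (hK : Monotone K) {t : TopologicalSpace (↥(⋃ n, K n))}
    (ht : ∀ U : Set (↥(⋃ n, K n)),
      (∀ n, IsOpen (Set.inclusion (Set.subset_iUnion K n) ⁻¹' U)) → t.IsOpen U)
    {ys : ℕ → ↥(⋃ n, K n)} {y : ↥(⋃ n, K n)}
    (h : Filter.Tendsto ys Filter.atTop (@nhds _ t y)) :
    ∃ n, ∀ᶠ i in Filter.atTop, (ys i : X) ∈ K n := by
  by_contra! hfreq
  obtain ⟨n₀, hn₀⟩ := Set.mem_iUnion.1 y.2
  obtain ⟨φ, hφ, hφK⟩ := Filter.extraction_forall_of_frequently fun n => hfreq (n + n₀)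
  -- The escaping subsequence meets each `K m` in a finite set, so its range is closed.
  have hopen : t.IsOpen (Set.range (ys ∘ φ))ᶜ := by
    refine ht _ fun m => ?_
    rw [Set.preimage_compl, isOpen_compl_iff]
    refine ((((Set.finite_Iio m).image (ys ∘ φ)).preimage
      (Set.inclusion_injective (Set.subset_iUnion K m)).injOn).subset ?_).isClosed
    rintro x ⟨n, hn⟩
    refine ⟨n, ?_, hn⟩
    by_contra hmn
    have hx : (ys (φ n) : X) = x := congrArg Subtype.val hn
    exact hφK n (hx ▸ hK ((not_lt.1 hmn).trans (Nat.le_add_right n n₀)) x.2)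
  have hy : y ∈ (Set.range (ys ∘ φ))ᶜ := by
    rintro ⟨n, rfl⟩
    exact hφK n (hK (Nat.le_add_left n₀ n) hn₀)
  obtain ⟨n, hn⟩ :=
    (hφ.tendsto_atTop.eventually (h (@IsOpen.mem_nhds _ t _ _ hopen hy))).exists
  exact hn ⟨n, rfl⟩

/-- Let `X` be a Hausdorff topological space and `K : ℕ → Set X` a sequence
of compact subsets with `K n ⊆ K (n+1)`, and equip `Y = ⋃ n, K n` with the final topology
(a set `U ⊆ Y` is open iff for every `n` its preimage in `K n` is open in the subspace
topology). A sequence `(y i)` in `Y` converges to `y ∈ Y` in the final topology iff there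
is `n` with `y ∈ K n`, `y i ∈ K n` for all `i`, and `y i → y` in the topology of `X`. -/
theorem direct_limit_of_compacts_tendsto_iff
    {X : Type*} [TopologicalSpace X] [T2Space X]
    (K : ℕ → Set X) (hK : ∀ n, IsCompact (K n)) (hmono : ∀ n, K n ⊆ K (n + 1))
    (t : TopologicalSpace (↥(⋃ n, K n)))
    (ht : ∀ U : Set (↥(⋃ n, K n)),
      t.IsOpen U ↔ ∀ n, IsOpen (Set.inclusion (Set.subset_iUnion K n) ⁻¹' U))
    (ys : ℕ → ↥(⋃ n, K n)) (y : ↥(⋃ n, K n)) :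
    Filter.Tendsto ys Filter.atTop (@nhds _ t y) ↔
      ∃ n, (y : X) ∈ K n ∧ (∀ i, (ys i : X) ∈ K n) ∧
        Filter.Tendsto (fun i => (ys i : X)) Filter.atTop (nhds (y : X)) := by
  have hK' : Monotone K := monotone_nat_of_le_succ hmono
  constructor
  · intro h
    obtain ⟨N, hN⟩ := exists_eventually_mem_of_tendsto_final hK' (fun U => (ht U).2) h
    obtain ⟨m, hm⟩ := exists_forall_mem_of_eventually_mem hK' (fun i => (ys i).2) hN
    obtain ⟨n₀, hn₀⟩ := Set.mem_iUnion.1 y.2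
    refine ⟨max m n₀, hK' (le_max_right _ _) hn₀, fun i => hK' (le_max_left _ _) (hm i), ?_⟩
    have hval : @Continuous _ _ t _ (Subtype.val : ↥(⋃ n, K n) → X) :=
      (@continuous_def _ _ t _ _).2 fun V hV =>
        (ht _).2 fun n => hV.preimage continuous_subtype_val
    exact (@Continuous.tendsto _ _ t _ _ hval y).comp h
  · rintro ⟨n, hy, hys, h⟩
    have hlift : Filter.Tendsto (fun i => (⟨ys i, hys i⟩ : K n)) Filter.atTop (nhds ⟨y, hy⟩) :=
      tendsto_subtype_rng.2 h
    have hincl : @Continuous _ _ _ t (Set.inclusion (Set.subset_iUnion K n)) :=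
      (@continuous_def _ _ _ t _).2 fun U hU => (ht U).1 hU n
    exact (@Continuous.tendsto _ _ _ t _ hincl ⟨y, hy⟩).comp hlift
end

section
/- Let ℓ > 0 and r > 0, let W : ℝ × ℝ → ℝ be continuous with W(s,t) > 0 for all (s,t) ∈ [0,ℓ] × (−r,r), and let ξ : ℝ → ℝ be continuous with M := sup_{s ∈ [0,ℓ]} |ξ(s)| < r/2. Then for every α ∈ [0,1] there exists a unique real number c(α) ∈ (−r/2, r/2) such that ∫₀^ℓ ( ∫₀^{α·ξ(s)+c(α)} W(s,t) dt ) ds = 0, where the inner integral is the signed (interval) integral. Moreover |c(α)| ≤ α·M for every α ∈ [0,1], and the function α ↦ c(α) is continuous on [0,1]. -/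
open MeasureTheory intervalIntegral

/-- The primitive of a continuous function that is positive on an order-connected set is strictly
increasing on that set. -/
theorem strictMonoOn_integral_of_pos {f : ℝ → ℝ} (hf : Continuous f) {I : Set ℝ}
    (hI : I.OrdConnected) (hpos : ∀ t ∈ I, 0 < f t) (a : ℝ) :
    StrictMonoOn (fun x => ∫ t in a..x, f t) I := by
  intro x hx y hy hxy
  have hsub := integral_interval_sub_left (μ := volume)
    (hf.intervalIntegrable a y) (hf.intervalIntegrable a x)
  have h := intervalIntegral_pos_of_pos_on (hf.intervalIntegrable x y)
    (fun t ht => hpos t (hI.out hx hy (Set.Ioo_subset_Icc_self ht))) hxy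
  change (∫ t in a..x, f t) < ∫ t in a..y, f t
  linarith

/-- The zero of a strictly increasing function depends continuously on a parameter. -/
theorem continuousOn_of_strictMonoOn_of_eq_zero {X : Type*} [TopologicalSpace X]
    {F : X → ℝ → ℝ} {A : Set X} {a b : ℝ} {c : X → ℝ}
    (hF : ∀ y, ContinuousOn (fun x => F x y) A)
    (hmono : ∀ x ∈ A, StrictMonoOn (F x) (Set.Ioo a b))
    (hc : ∀ x ∈ A, c x ∈ Set.Ioo a b) (hzero : ∀ x ∈ A, F x (c x) = 0) :
    ContinuousOn c A := by
  intro x hx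
  refine tendsto_order.2 ⟨fun y hy => ?_, fun y hy => ?_⟩
  · obtain ⟨z, hyz, hz⟩ := exists_between (max_lt hy (hc x hx).1)
    have hzI : z ∈ Set.Ioo a b :=
      ⟨(le_max_right _ _).trans_lt hyz, hz.trans (hc x hx).2⟩
    have hneg : F x z < 0 := hzero x hx ▸ hmono x hx hzI (hc x hx) hz
    filter_upwards [(hF z x hx).eventually_lt_const hneg, self_mem_nhdsWithin] with w hw hwA
    rw [← hzero w hwA, (hmono w hwA).lt_iff_lt hzI (hc w hwA)] at hw
    exact ((le_max_left _ _).trans_lt hyz).trans hw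
  · obtain ⟨z, hz, hzy⟩ := exists_between (lt_min hy (hc x hx).2)
    have hzI : z ∈ Set.Ioo a b :=
      ⟨(hc x hx).1.trans hz, hzy.trans_le (min_le_right _ _)⟩
    have hpos : 0 < F x z := hzero x hx ▸ hmono x hx (hc x hx) hzI hz
    filter_upwards [(hF z x hx).eventually_const_lt hpos, self_mem_nhdsWithin] with w hw hwA
    rw [← hzero w hwA, (hmono w hwA).lt_iff_lt (hc w hwA) hzI] at hw
    exact hw.trans (hzy.trans_le (min_le_left _ _))

/-- Let `ℓ > 0`, `r > 0`, let `W : ℝ × ℝ → ℝ` be continuous and strictly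
positive on `[0,ℓ] × (−r,r)`, and let `ξ : ℝ → ℝ` be continuous with
`M := sup_{s ∈ [0,ℓ]} |ξ s| < r/2`. Then for every `α ∈ [0,1]` there is a unique
`c α ∈ (−r/2, r/2)` with `∫₀^ℓ (∫₀^{α ξ(s) + c α} W(s,t) dt) ds = 0` (signed inner
integral); moreover `|c α| ≤ α * M` and `α ↦ c α` is continuous on `[0,1]`. -/
theorem exists_unique_exactness_constant
    (ℓ r : ℝ) (hℓ : 0 < ℓ) (hr : 0 < r)
    (W : ℝ × ℝ → ℝ) (hW : Continuous W)
    (hWpos : ∀ s t : ℝ, s ∈ Set.Icc 0 ℓ → t ∈ Set.Ioo (-r) r → 0 < W (s, t))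
    (ξ : ℝ → ℝ) (hξ : Continuous ξ)
    (M : ℝ) (hM : M = sSup ((fun s => |ξ s|) '' Set.Icc 0 ℓ))
    (hMr : M < r / 2) :
    ∃ c : ℝ → ℝ,
      (∀ α ∈ Set.Icc (0 : ℝ) 1,
        c α ∈ Set.Ioo (-(r / 2)) (r / 2) ∧
        (∫ s in (0 : ℝ)..ℓ, ∫ t in (0 : ℝ)..(α * ξ s + c α), W (s, t)) = 0 ∧
        (∀ c' ∈ Set.Ioo (-(r / 2)) (r / 2),
          (∫ s in (0 : ℝ)..ℓ, ∫ t in (0 : ℝ)..(α * ξ s + c'), W (s, t)) = 0 → c' = c α) ∧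
        |c α| ≤ α * M) ∧
      ContinuousOn c (Set.Icc 0 1) := by
  have hξM : ∀ s ∈ Set.Icc 0 ℓ, |ξ s| ≤ M := fun s hs => hM ▸
    le_csSup (isCompact_Icc.image hξ.abs).bddAbove (Set.mem_image_of_mem _ hs)
  have hM0 : 0 ≤ M := (abs_nonneg _).trans (hξM 0 ⟨le_rfl, hℓ.le⟩)
  have hαξ : ∀ α ∈ Set.Icc (0 : ℝ) 1, ∀ s ∈ Set.Icc 0 ℓ, |α * ξ s| ≤ α * M := fun α hα s hs => by
    rw [abs_mul, abs_of_nonneg hα.1]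
    exact mul_le_mul_of_nonneg_left (hξM s hs) hα.1
  have hαM : ∀ α ∈ Set.Icc (0 : ℝ) 1, α * M ≤ M := fun α hα => mul_le_of_le_one_left hM0 hα.2
  have hmem : ∀ α ∈ Set.Icc (0 : ℝ) 1, ∀ s ∈ Set.Icc 0 ℓ, ∀ c ∈ Set.Ioo (-(r / 2)) (r / 2),
      α * ξ s + c ∈ Set.Ioo (-r) r := fun α hα s hs c hc => by
    have h₁ := abs_le.1 (hαξ α hα s hs)
    have h₂ := hαM α hα
    constructor <;> linarith [h₁.1, h₁.2, hc.1, hc.2]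
  have hprim : ∀ s ∈ Set.Icc 0 ℓ,
      StrictMonoOn (fun x => ∫ t in (0 : ℝ)..x, W (s, t)) (Set.Ioo (-r) r) := fun s hs =>
    strictMonoOn_integral_of_pos (by fun_prop) Set.ordConnected_Ioo (fun t => hWpos s t hs) 0
  have hinner : Continuous fun p : (ℝ × ℝ) × ℝ =>
      ∫ t in (0 : ℝ)..(p.1.1 * ξ p.2 + p.1.2), W (p.2, t) :=
    continuous_parametric_intervalIntegral_of_continuous
      (f := fun (p : (ℝ × ℝ) × ℝ) t => W (p.2, t)) (by fun_prop) (by fun_prop)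
  have hinner_s : ∀ α c : ℝ, Continuous fun s =>
      ∫ t in (0 : ℝ)..(α * ξ s + c), W (s, t) := fun α c =>
    hinner.comp (f := fun s => ((α, c), s)) (by fun_prop)
  set F : ℝ → ℝ → ℝ := fun α c =>
    ∫ s in (0 : ℝ)..ℓ, ∫ t in (0 : ℝ)..(α * ξ s + c), W (s, t)
  have hFcont : Continuous fun p : ℝ × ℝ => F p.1 p.2 :=
    continuous_parametric_intervalIntegral_of_continuous' (μ := volume)
      (f := fun (p : ℝ × ℝ) s => ∫ t in (0 : ℝ)..(p.1 * ξ s + p.2), W (s, t)) hinner 0 ℓ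
  have hFmono : ∀ α ∈ Set.Icc (0 : ℝ) 1, StrictMonoOn (F α) (Set.Ioo (-(r / 2)) (r / 2)) := by
    intro α hα c hc c' hc' hcc'
    have hlt : ∀ s ∈ Set.Icc 0 ℓ, (∫ t in (0 : ℝ)..(α * ξ s + c), W (s, t)) <
        ∫ t in (0 : ℝ)..(α * ξ s + c'), W (s, t) := fun s hs =>
      hprim s hs (hmem α hα s hs c hc) (hmem α hα s hs c' hc') (by linarith)
    exact integral_lt_integral_of_continuousOn_of_le_of_exists_lt hℓ
      (hinner_s α c).continuousOn (hinner_s α c').continuousOn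
      (fun s hs => (hlt s (Set.Ioc_subset_Icc_self hs)).le)
      ⟨0, ⟨le_rfl, hℓ.le⟩, hlt 0 ⟨le_rfl, hℓ.le⟩⟩
  have hr0 : (0 : ℝ) ∈ Set.Ioo (-r) r := ⟨by linarith, hr⟩
  have hexists : ∀ α ∈ Set.Icc (0 : ℝ) 1, ∃ c ∈ Set.Icc (-(α * M)) (α * M), F α c = 0 := by
    intro α hα
    have h₀ : 0 ≤ α * M := mul_nonneg hα.1 hM0
    have h₁ := hαM α hα
    have hlow : F α (-(α * M)) ≤ 0 := by
      refine (integral_mono_on (g := fun _ => (0 : ℝ)) hℓ.le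
        ((hinner_s α _).intervalIntegrable 0 ℓ) (by simp) fun s hs => ?_).trans_eq (by simp)
      have h := (hprim s hs).monotoneOn
        (hmem α hα s hs (-(α * M)) ⟨by linarith, by linarith⟩) hr0
        (by linarith [(abs_le.1 (hαξ α hα s hs)).2])
      simpa using h
    have hhigh : 0 ≤ F α (α * M) := by
      refine integral_nonneg hℓ.le fun s hs => ?_
      have h := (hprim s hs).monotoneOn hr0
        (hmem α hα s hs (α * M) ⟨by linarith, by linarith⟩)
        (by linarith [(abs_le.1 (hαξ α hα s hs)).1])
      simpa using h
    have hcont : Continuous (F α) := hFcont.comp (Continuous.prodMk_right α)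
    exact intermediate_value_Icc (by linarith) hcont.continuousOn ⟨hlow, hhigh⟩
  choose! c hcM hc0 using hexists
  have hc : ∀ α ∈ Set.Icc (0 : ℝ) 1, c α ∈ Set.Ioo (-(r / 2)) (r / 2) := fun α hα =>
    ⟨by linarith [(hcM α hα).1, hαM α hα], by linarith [(hcM α hα).2, hαM α hα]⟩
  refine ⟨c, fun α hα => ⟨hc α hα, hc0 α hα, fun c' hc' h => ?_, abs_le.2 (hcM α hα)⟩, ?_⟩
  · exact (hFmono α hα).injOn hc' (hc α hα) (h.trans (hc0 α hα).symm)
  · exact continuousOn_of_strictMonoOn_of_eq_zero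
      (fun y => (hFcont.comp (Continuous.prodMk_left y)).continuousOn) hFmono hc hc0
end

section
/- Let ℓ > 0 and r > 0, let W : ℝ × ℝ → ℝ be continuous with W(s,t) > 0 for all (s,t) ∈ [0,ℓ] × (−r,r), and let ξ : ℝ → ℝ be continuous with M := sup_{s ∈ [0,ℓ]} |ξ(s)| < r/3. For each α ∈ [0,1] let c(α) ∈ (−r/2, r/2) be the unique real number with ∫₀^ℓ ( ∫₀^{α·ξ(s)+c(α)} W(s,t) dt ) ds = 0. Then for all α, α' ∈ [0,1] one has |c(α) − c(α')| ≤ M · |α − α'|. -/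
open MeasureTheory intervalIntegral

/-- The signed area between the axis and a graph is strictly monotone in the graph, as long as
the density is positive on a strip containing the graphs. -/
theorem integral_integral_lt_of_lt {a b r : ℝ} (hab : a < b) {W : ℝ × ℝ → ℝ} (hW : Continuous W)
    (hWpos : ∀ s t : ℝ, s ∈ Set.Icc a b → t ∈ Set.Ioo (-r) r → 0 < W (s, t))
    {f g : ℝ → ℝ} (hf : Continuous f) (hg : Continuous g)
    (hfr : ∀ s ∈ Set.Icc a b, -r < f s) (hgr : ∀ s ∈ Set.Icc a b, g s < r)
    (hfg : ∀ s ∈ Set.Icc a b, f s < g s) :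
    (∫ s in a..b, ∫ t in (0 : ℝ)..f s, W (s, t)) < ∫ s in a..b, ∫ t in (0 : ℝ)..g s, W (s, t) := by
  have hcont {u : ℝ → ℝ} (hu : Continuous u) :
      Continuous fun s => ∫ t in (0 : ℝ)..u s, W (s, t) :=
    continuous_parametric_intervalIntegral_of_continuous (f := fun s t => W (s, t)) hW hu
  have hlt : ∀ s ∈ Set.Icc a b, (∫ t in (0 : ℝ)..f s, W (s, t)) < ∫ t in (0 : ℝ)..g s, W (s, t) := by
    intro s hs
    have hi (x y : ℝ) : IntervalIntegrable (fun t => W (s, t)) volume x y :=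
      (hW.comp (Continuous.prodMk_right s)).intervalIntegrable x y
    rw [← sub_pos, integral_interval_sub_left (hi _ _) (hi _ _)]
    refine intervalIntegral_pos_of_pos_on (hi _ _) (fun t ht => hWpos s t hs ?_) (hfg s hs)
    exact ⟨(hfr s hs).trans ht.1, ht.2.trans (hgr s hs)⟩
  exact integral_lt_integral_of_continuousOn_of_le_of_exists_lt hab (hcont hf).continuousOn
    (hcont hg).continuousOn (fun s hs => (hlt s (Set.Ioc_subset_Icc_self hs)).le)
    ⟨a, Set.left_mem_Icc.2 hab.le, hlt a (Set.left_mem_Icc.2 hab.le)⟩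

/-- Let `ℓ > 0`, `r > 0`, let `W : ℝ × ℝ → ℝ` be continuous and strictly
positive on `[0,ℓ] × (−r,r)`, and let `ξ : ℝ → ℝ` be continuous with
`M := sup_{s ∈ [0,ℓ]} |ξ s| < r/3`. For each `α ∈ [0,1]` let `c α ∈ (−r/2, r/2)` be the
unique real number with `∫₀^ℓ (∫₀^{α ξ(s) + c α} W(s,t) dt) ds = 0`. Then for all
`α, α' ∈ [0,1]` one has `|c α − c α'| ≤ M * |α − α'|`. -/
theorem exactness_constant_lipschitz
    (ℓ r : ℝ) (hℓ : 0 < ℓ) (hr : 0 < r)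
    (W : ℝ × ℝ → ℝ) (hW : Continuous W)
    (hWpos : ∀ s t : ℝ, s ∈ Set.Icc 0 ℓ → t ∈ Set.Ioo (-r) r → 0 < W (s, t))
    (ξ : ℝ → ℝ) (hξ : Continuous ξ)
    (M : ℝ) (hM : M = sSup ((fun s => |ξ s|) '' Set.Icc 0 ℓ))
    (hMr : M < r / 3)
    (c : ℝ → ℝ)
    (hc : ∀ α ∈ Set.Icc (0 : ℝ) 1,
      c α ∈ Set.Ioo (-(r / 2)) (r / 2) ∧
      (∫ s in (0 : ℝ)..ℓ, ∫ t in (0 : ℝ)..(α * ξ s + c α), W (s, t)) = 0) :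
    ∀ α ∈ Set.Icc (0 : ℝ) 1, ∀ α' ∈ Set.Icc (0 : ℝ) 1,
      |c α - c α'| ≤ M * |α - α'| := by
  have hξM : ∀ s ∈ Set.Icc 0 ℓ, |ξ s| ≤ M := fun s hs => hM ▸
    le_csSup (isCompact_Icc.image hξ.abs).bddAbove (Set.mem_image_of_mem _ hs)
  have hrange : ∀ α ∈ Set.Icc (0 : ℝ) 1, ∀ s ∈ Set.Icc 0 ℓ, |α * ξ s + c α| < r := by
    intro α hα s hs
    have hmul : |α * ξ s| ≤ M := by
      rw [abs_mul, abs_of_nonneg hα.1]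
      exact (mul_le_of_le_one_left (abs_nonneg _) hα.2).trans (hξM s hs)
    have hcα : |c α| < r / 2 := abs_lt.2 (hc α hα).1
    linarith [abs_add_le (α * ξ s) (c α)]
  have key : ∀ α ∈ Set.Icc (0 : ℝ) 1, ∀ α' ∈ Set.Icc (0 : ℝ) 1,
      c α - c α' ≤ M * |α - α'| := by
    intro α hα α' hα'
    by_contra! hlt
    refine (integral_integral_lt_of_lt hℓ hW hWpos (f := fun s => α' * ξ s + c α')
      (g := fun s => α * ξ s + c α) (by fun_prop) (by fun_prop)
      (fun s hs => (abs_lt.1 (hrange α' hα' s hs)).1)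
      (fun s hs => (abs_lt.1 (hrange α hα s hs)).2) fun s hs => ?_).ne
      ((hc α' hα').2.trans (hc α hα).2.symm)
    have hdiff : |(α - α') * ξ s| ≤ M * |α - α'| := by
      rw [abs_mul, mul_comm]
      exact mul_le_mul_of_nonneg_right (hξM s hs) (abs_nonneg _)
    linarith [neg_abs_le ((α - α') * ξ s)]
  intro α hα α' hα'
  refine abs_sub_le_iff.2 ⟨key α hα α' hα', ?_⟩
  rw [abs_sub_comm α α']
  exact key α' hα' α hα
end
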